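/- Let p be a prime and G an abelian group. If x ∈ G is such that p^n x ∈ ⋂_{m≥1} p^m G for some integer n ≥ 0, then x ∈ G_tors + pG. -/

import Mathlib

theorem stmt_3 (p : ℕ) (hp : p.Prime) (G : Type*) [AddCommGroup G]
    (x : G) (n : ℕ)
    (hx : ∀ m : ℕ, 1 ≤ m → ∃ y : G, p ^ n • x = p ^ m • y) :
    ∃ t y : G, IsOfFinAddOrder t ∧ x = t + p • y := by
  obtain ⟨y, hy⟩ := hx (n + 1) (by omega)
  refine ⟨x - p • y, y, ?_, by abel⟩
  rw [isOfFinAddOrder_iff_nsmul_eq_zero]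
  refine ⟨p ^ n, pow_pos hp.pos n, ?_⟩
  rw [nsmul_sub, hy, pow_succ, mul_nsmul', sub_self]
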